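/- arXiv:2203.06353 — 2 statements merged into one kernel-verified Lean document; each statement's English description precedes it below -/
import Mathlib

section
/- Let S be a nonempty subset of the set X* of Pareto optimal outcomes. There exists an ex-ante efficient lottery whose support equals S if and only if there is no vector α : X* → ℝ such that α_x ≥ 0 for all x ∈ X*∖S, ∑_{x∈X*} α_x = 0, ∑_{y∈X* : y ≻_i x} α_y ≥ 0 for all agents i ∈ N and all x ∈ X*, and at least one of these last inequalities is strict. -/
attribute [local instance] Classical.propDecidable

/-- The strict part of a preference relation. -/
def strictPref {X : Type*} (r : X → X → Prop) (x y : X) : Prop := r x y ∧ ¬ r y x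

/-- A preference: a complete (total) and transitive binary relation. -/
def IsPrefOrder {X : Type*} (r : X → X → Prop) : Prop :=
  (∀ x y, r x y ∨ r y x) ∧ Transitive r

/-- A lottery over the finite set of outcomes `X`. -/
def IsLottery {X : Type*} [Fintype X] (p : X → ℝ) : Prop :=
  (∀ x, 0 ≤ p x) ∧ ∑ x, p x = 1

/-- Total weight a lottery `p` places on outcomes strictly preferred to `x`. -/
noncomputable def upWeight {X : Type*} [Fintype X] (r : X → X → Prop) (p : X → ℝ) (x : X) : ℝ :=
  ∑ y ∈ Finset.univ.filter (fun y => strictPref r y x), p y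

/-- First-order stochastic dominance (weak): `p ≿ q`. -/
def SDge {X : Type*} [Fintype X] (r : X → X → Prop) (p q : X → ℝ) : Prop :=
  ∀ x, upWeight r q x ≤ upWeight r p x

/-- First-order stochastic dominance (strict): `p ≻ q`. -/
def SDgt {X : Type*} [Fintype X] (r : X → X → Prop) (p q : X → ℝ) : Prop :=
  SDge r p q ∧ ∃ x, upWeight r q x < upWeight r p x

/-- A lottery `p` is ex-ante efficient if no lottery weakly SD-dominates it for all agents
and strictly for some agent. -/
def ExAnteEff {X N : Type*} [Fintype X] (pref : N → X → X → Prop) (p : X → ℝ) : Prop :=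
  ¬ ∃ q : X → ℝ, IsLottery q ∧ (∀ i, SDge (pref i) q p) ∧ ∃ j, SDgt (pref j) q p

/-- An outcome is Pareto optimal if no outcome is weakly better for all agents and
strictly better for some agent. -/
def ParetoOptimal {X N : Type*} (pref : N → X → X → Prop) (x : X) : Prop :=
  ¬ ∃ y, (∀ i, pref i y x) ∧ ∃ j, strictPref (pref j) y x

/-- A lottery is ex-post efficient if it is supported on Pareto optimal outcomes. -/
def ExPostEff {X N : Type*} [Fintype X] (pref : N → X → X → Prop) (p : X → ℝ) : Prop :=
  ∀ x, 0 < p x → ParetoOptimal pref x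

/-- `u` is a utility representation of the preference `r`. -/
def Represents {X : Type*} (u : X → ℝ) (r : X → X → Prop) : Prop :=
  ∀ x y, (u y ≤ u x ↔ r x y)

theorem wellFounded_strictPref {X : Type*} [Finite X] {r : X → X → Prop} (hr : Transitive r) :
    WellFounded (strictPref r) :=
  haveI : IsTrans X (strictPref r) :=
    ⟨fun _ _ _ hab hbc => ⟨hr hab.1 hbc.1, fun hca => hab.2 (hr hbc.1 hca)⟩⟩
  haveI : Std.Irrefl (strictPref r) := ⟨fun _ h => h.2 h.1⟩
  Finite.wellFounded_of_trans_of_irrefl _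

/-- Every outcome is weakly Pareto dominated by a Pareto optimal one. -/
theorem exists_paretoOptimal_forall_pref {X N : Type*} [Finite X] {pref : N → X → X → Prop}
    (hpref : ∀ i, IsPrefOrder (pref i)) (x : X) :
    ∃ y, ParetoOptimal pref y ∧ ∀ i, pref i y x := by
  have htrans : Transitive fun a b => ∀ i, pref i a b :=
    fun _ _ _ hab hbc i => (hpref i).2 (hab i) (hbc i)
  obtain ⟨y, hy, hmin⟩ := (wellFounded_strictPref htrans).has_min {y | ∀ i, pref i y x}
    ⟨x, fun i => ((hpref i).1 x x).elim id id⟩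
  refine ⟨y, ?_, hy⟩
  rintro ⟨z, hz, j, hj⟩
  exact hmin z (htrans hz hy) ⟨hz, fun h => hj.2 (h j)⟩

/-- On the outcomes satisfying `P`, a strict upper contour set is either everything or the strict
upper contour set of an outcome satisfying `P`. -/
theorem forall_strictPref_or_exists_iff {X : Type*} [Finite X] {r : X → X → Prop}
    (hr : IsPrefOrder r) (P : X → Prop) (x : X) :
    (∀ y, P y → strictPref r y x) ∨
      ∃ z, P z ∧ ∀ y, P y → (strictPref r y x ↔ strictPref r y z) := by
  by_cases h : ∀ y, P y → strictPref r y x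
  · exact Or.inl h
  · right
    push Not at h
    obtain ⟨z, ⟨hPz, hzx⟩, hmin⟩ := (wellFounded_strictPref hr.2).has_min
      {y | P y ∧ ¬ strictPref r y x} h
    have hxz : r x z := by
      by_contra hxz
      exact hzx ⟨(hr.1 x z).resolve_left hxz, hxz⟩
    refine ⟨z, hPz, fun y hPy => ⟨fun hyx => ⟨hr.2 hyx.1 hxz, fun hzy => hyx.2 (hr.2 hxz hzy)⟩,
      fun hyz => ?_⟩⟩
    by_contra hyx
    exact hmin y ⟨hPy, hyx⟩ hyz

/-- A vector of total weight zero on the outcomes satisfying `P` has the same upper weight at any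
outcome as at some outcome satisfying `P`, unless that upper weight vanishes. -/
theorem sum_strictPref_eq_zero_or_exists_eq {X : Type*} [Fintype X] {r : X → X → Prop}
    (hr : IsPrefOrder r) (P : X → Prop) (α : X → ℝ)
    (hα : ∑ y ∈ Finset.univ.filter (fun y => P y), α y = 0) (x : X) :
    ∑ y ∈ Finset.univ.filter (fun y => P y ∧ strictPref r y x), α y = 0 ∨
      ∃ z, P z ∧ ∑ y ∈ Finset.univ.filter (fun y => P y ∧ strictPref r y x), α y =
        ∑ y ∈ Finset.univ.filter (fun y => P y ∧ strictPref r y z), α y := by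
  rcases forall_strictPref_or_exists_iff hr P x with h | ⟨z, hz, h⟩
  · left
    rw [← hα]
    exact Finset.sum_congr (Finset.filter_congr fun y _ => and_iff_left_of_imp (h y))
      fun _ _ => rfl
  · exact Or.inr ⟨z, hz, Finset.sum_congr
      (Finset.filter_congr fun y _ => and_congr_right (h y)) fun _ _ => rfl⟩

theorem upWeight_add_mul_ite {X : Type*} [Fintype X] (r : X → X → Prop) (P : X → Prop)
    (p α : X → ℝ) (ε : ℝ) (x : X) :
    upWeight r (fun y => p y + ε * if P y then α y else 0) x =
      upWeight r p x +
        ε * ∑ y ∈ Finset.univ.filter (fun y => P y ∧ strictPref r y x), α y := by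
  simp only [upWeight, Finset.sum_add_distrib, ← Finset.mul_sum, ← Finset.sum_filter,
    Finset.filter_filter, and_comm]

/-- Moving every outcome weakly up raises all upper weights. -/
theorem upWeight_le_upWeight_map {X : Type*} [Fintype X] {r : X → X → Prop}
    (hr : Transitive r) {f : X → X} (hf : ∀ x, r (f x) x) {q : X → ℝ} (hq : ∀ x, 0 ≤ q x)
    (x : X) :
    upWeight r q x ≤
      upWeight r (fun y => ∑ z ∈ Finset.univ.filter (fun z => f z = y), q z) x := by
  have hmap : upWeight r (fun y => ∑ z ∈ Finset.univ.filter (fun z => f z = y), q z) x =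
      ∑ z ∈ Finset.univ.filter (fun z => strictPref r (f z) x), q z := by
    rw [upWeight, Finset.sum_comm' (t' := Finset.univ.filter fun z => strictPref r (f z) x)
      (s' := fun z => {f z})]
    · simp
    · simp only [Finset.mem_filter, Finset.mem_univ, true_and, Finset.mem_singleton]
      grind
  rw [hmap]
  refine Finset.sum_le_sum_of_subset_of_nonneg (fun z hz => ?_) fun z _ _ => hq z
  simp only [Finset.mem_filter, Finset.mem_univ, true_and] at hz ⊢
  exact ⟨hr (hf z) hz.1, fun h => hz.2 (hr h (hf z))⟩

/-- A lottery can be perturbed slightly in any direction that is nonnegative off its support. -/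
theorem exists_pos_forall_nonneg_add_mul {X : Type*} [Finite X] {p β : X → ℝ}
    (hp : ∀ x, 0 ≤ p x) (hβ : ∀ x, p x = 0 → 0 ≤ β x) :
    ∃ ε : ℝ, 0 < ε ∧ ∀ x, 0 ≤ p x + ε * β x := by
  have h : ∀ᶠ ε : ℝ in nhdsWithin 0 (Set.Ioi 0), ∀ x, 0 ≤ p x + ε * β x := by
    rw [Filter.eventually_all]
    intro x
    rcases (hp x).eq_or_lt with h0 | hpos
    · filter_upwards [self_mem_nhdsWithin] with ε hε
      rw [← h0, zero_add]
      exact mul_nonneg (le_of_lt hε) (hβ x h0.symm)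
    · have hcont : Filter.Tendsto (fun ε : ℝ => p x + ε * β x) (nhds 0) (nhds (p x)) := by
        have : Continuous fun ε : ℝ => p x + ε * β x := by fun_prop
        simpa using this.tendsto 0
      filter_upwards [(hcont.mono_left nhdsWithin_le_nhds).eventually (lt_mem_nhds hpos)]
        with ε hε using hε.le
  obtain ⟨ε, h, hε⟩ := (h.and self_mem_nhdsWithin).exists
  exact ⟨ε, hε, h⟩

/-- A nonempty set `S` of Pareto optimal outcomes supports an ex-ante efficient
lottery iff the associated linear system has no (partially nonnegative) solution `α`. -/
theorem stmt_2 {X N : Type*} [Fintype X] [Nonempty X] [Fintype N] [Nonempty N]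
    (pref : N → X → X → Prop) (hpref : ∀ i, IsPrefOrder (pref i))
    (S : Finset X) (hSne : S.Nonempty) (hS : ∀ x ∈ S, ParetoOptimal pref x) :
    (∃ p : X → ℝ, IsLottery p ∧ ExAnteEff pref p ∧ (∀ x, 0 < p x ↔ x ∈ S)) ↔
      ¬ ∃ α : X → ℝ,
        (∀ x, ParetoOptimal pref x → x ∉ S → 0 ≤ α x) ∧
        (∑ x ∈ Finset.univ.filter (fun x => ParetoOptimal pref x), α x = 0) ∧
        (∀ i x, ParetoOptimal pref x →
          0 ≤ ∑ y ∈ Finset.univ.filter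
              (fun y => ParetoOptimal pref y ∧ strictPref (pref i) y x), α y) ∧
        (∃ i x, ParetoOptimal pref x ∧
          0 < ∑ y ∈ Finset.univ.filter
              (fun y => ParetoOptimal pref y ∧ strictPref (pref i) y x), α y) := by
  constructor
  · rintro ⟨p, hp, heff, hsupp⟩ ⟨α, hα, hsum, hge, j, x₀, -, hgt⟩
    have hge' : ∀ i x, 0 ≤ ∑ y ∈ Finset.univ.filter
        (fun y => ParetoOptimal pref y ∧ strictPref (pref i) y x), α y := by
      intro i x
      rcases sum_strictPref_eq_zero_or_exists_eq (hpref i) _ α hsum x with h | ⟨z, hz, h⟩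
      · exact h.ge
      · exact h ▸ hge i z hz
    obtain ⟨ε, hε, hnonneg⟩ := exists_pos_forall_nonneg_add_mul
      (β := fun x => if ParetoOptimal pref x then α x else 0) hp.1 (by
        intro x hx
        split_ifs with hP
        · exact hα x hP fun hxS => ((hsupp x).2 hxS).ne' hx
        · exact le_rfl)
    have hSD : ∀ i, SDge (pref i)
        (fun y => p y + ε * if ParetoOptimal pref y then α y else 0) p := by
      intro i x
      rw [upWeight_add_mul_ite]
      exact le_add_of_nonneg_right (mul_nonneg hε.le (hge' i x))
    refine heff ⟨_, ⟨hnonneg, ?_⟩, hSD, j, hSD j, x₀, ?_⟩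
    · rw [Finset.sum_add_distrib, ← Finset.mul_sum, ← Finset.sum_filter, hsum, hp.2]
      ring
    · rw [upWeight_add_mul_ite]
      exact lt_add_of_pos_right _ (mul_pos hε hgt)
  · intro hno
    have hcard : (0 : ℝ) < S.card := by exact_mod_cast hSne.card_pos
    set p : X → ℝ := fun x => if x ∈ S then (S.card : ℝ)⁻¹ else 0 with hpdef
    have hp : IsLottery p := by
      refine ⟨fun x => ?_, ?_⟩
      · simp only [hpdef]
        split_ifs <;> positivity
      · simp [hpdef, hcard.ne']
    have hpsupp : ∀ x, 0 < p x ↔ x ∈ S := by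
      intro x
      by_cases hx : x ∈ S <;> simp [hpdef, hx, hSne]
    refine ⟨p, hp, ?_, hpsupp⟩
    rintro ⟨q, hq, hSD, j, -, x₀, hgt⟩
    choose f hfP hf using exists_paretoOptimal_forall_pref hpref
    set q' : X → ℝ := fun y => ∑ z ∈ Finset.univ.filter (fun z => f z = y), q z with hq'
    have hle : ∀ i x, upWeight (pref i) q x ≤ upWeight (pref i) q' x := fun i =>
      upWeight_le_upWeight_map (hpref i).2 (fun x => hf x i) hq.1
    have hzero : ∀ x, ¬ ParetoOptimal pref x → q' x - p x = 0 := by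
      intro x hx
      have hxS : x ∉ S := fun h => hx (hS x h)
      have hfx : ∀ z, f z ≠ x := fun z h => hx (h ▸ hfP z)
      simp [hq', hpdef, hxS, hfx]
    have hup : ∀ i x, ∑ y ∈ Finset.univ.filter
        (fun y => ParetoOptimal pref y ∧ strictPref (pref i) y x), (q' y - p y) =
        upWeight (pref i) q' x - upWeight (pref i) p x := by
      intro i x
      rw [upWeight, upWeight, ← Finset.sum_sub_distrib]
      refine Finset.sum_subset (fun y hy => ?_) fun y hy hy' => hzero y fun hP => hy' ?_
      · simp only [Finset.mem_filter] at hy ⊢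
        exact ⟨hy.1, hy.2.2⟩
      · simp only [Finset.mem_filter] at hy ⊢
        exact ⟨hy.1, hP, hy.2⟩
    have hsum : ∑ y ∈ Finset.univ.filter (fun y => ParetoOptimal pref y), (q' y - p y) = 0 := by
      have hfib : ∑ y, q' y = ∑ z, q z :=
        Finset.sum_fiberwise_of_maps_to (fun z _ => Finset.mem_univ (f z)) q
      rw [Finset.sum_subset (Finset.subset_univ _) fun y _ hy => hzero y (by simpa using hy),
        Finset.sum_sub_distrib, hfib, hq.2, hp.2, sub_self]
    have hpos : 0 < ∑ y ∈ Finset.univ.filter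
        (fun y => ParetoOptimal pref y ∧ strictPref (pref j) y x₀), (q' y - p y) := by
      rw [hup]
      exact sub_pos.2 (hgt.trans_le (hle j x₀))
    refine hno ⟨fun y => q' y - p y, fun x _ hxS => ?_, hsum, fun i x _ => ?_, j, ?_⟩
    · simp only [hpdef, if_neg hxS, sub_zero]
      exact Finset.sum_nonneg fun z _ => hq.1 z
    · rw [hup]
      exact sub_nonneg.2 ((hSD i x).trans (hle i x))
    · rcases sum_strictPref_eq_zero_or_exists_eq (hpref j) _ _ hsum x₀ with h | ⟨z, hz, h⟩
      · exact absurd h hpos.ne'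
      · exact ⟨z, hz, h ▸ hpos⟩
end

section
/- Let S be a nonempty subset of the set X* of Pareto optimal outcomes. There exists an ex-ante efficient lottery whose support equals S if and only if for no K ≥ 1 do there exist finite sequences (a_k)_{k=1,…,K} of outcomes from X* and (b_k)_{k=1,…,K} of outcomes from S such that: no outcome occurs in both sequences, each outcome occurs in its sequence at most |X*|^{|X*|/2} times, for every agent i ∈ N and every outcome x ∈ X* one has |{k : a_k ≻_i x}| ≥ |{k : b_k ≻_i x}|, and this inequality is strict for at least one pair (i, x). -/
attribute [local instance] Classical.propDecidable

/-- **Hadamard's inequality** for a real matrix whose entries have absolute value at most `1`. -/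
theorem abs_det_le_sqrt_card_pow {V : Type*} [Fintype V] (M : Matrix V V ℝ)
    (hM : ∀ i j, |M i j| ≤ 1) :
    |M.det| ≤ √(Fintype.card V : ℝ) ^ Fintype.card V := by
  set n := Fintype.card V with hn
  let e : V ≃ Fin n := Fintype.equivFin V
  let A : Matrix (Fin n) (Fin n) ℝ := M.reindex e e
  have hA : M.det = A.det := (Matrix.det_reindex_self e M).symm
  let b := EuclideanSpace.basisFun (Fin n) ℝ
  let v : Fin n → EuclideanSpace ℝ (Fin n) := fun i => WithLp.toLp 2 (A i)
  have : Fact (Module.finrank ℝ (EuclideanSpace ℝ (Fin n)) = n) := ⟨by simp⟩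
  have hv : b.toBasis.det v = A.det := by
    rw [Module.Basis.det_apply, ← Matrix.det_transpose]
    congr 1
  have hnorm : ∀ i, ‖v i‖ ≤ √(n : ℝ) := fun i => by
    rw [EuclideanSpace.norm_eq]
    refine Real.sqrt_le_sqrt ?_
    calc ∑ j, ‖v i j‖ ^ 2 ≤ ∑ _j : Fin n, (1 : ℝ) :=
          Finset.sum_le_sum fun j _ => pow_le_one₀ (norm_nonneg _) (hM _ _)
      _ = n := by simp
  calc |M.det| = |b.toBasis.orientation.volumeForm v| := by
        rw [Orientation.volumeForm_robust' _ b, hv, hA]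
    _ ≤ ∏ i, ‖v i‖ := Orientation.abs_volumeForm_apply_le _ v
    _ ≤ ∏ _i : Fin n, √(n : ℝ) :=
        Finset.prod_le_prod (fun i _ => norm_nonneg _) fun i _ => hnorm i
    _ = √(n : ℝ) ^ n := by simp

/-- The value at `d` of the linear functional with integer coefficients `w`. -/
def intDot {V : Type*} [Fintype V] (w : V → ℤ) (d : V → ℝ) : ℝ := ∑ x, (w x : ℝ) * d x

section IntDot

variable {V : Type*} [Fintype V]

theorem intDot_add_smul (w : V → ℤ) (d e : V → ℝ) (t : ℝ) :
    intDot w (d + t • e) = intDot w d + t * intDot w e := by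
  simp only [intDot, Pi.add_apply, Pi.smul_apply, smul_eq_mul, mul_add, Finset.sum_add_distrib,
    Finset.mul_sum]
  congr 1
  exact Finset.sum_congr rfl fun x _ => by ring

theorem intDot_neg (w : V → ℤ) (e : V → ℝ) : intDot w (-e) = -intDot w e := by
  simp [intDot]

theorem intDot_single [DecidableEq V] (x : V) (s : ℤ) (d : V → ℝ) :
    intDot (Pi.single x s) d = s * d x := by
  simp only [intDot]
  rw [Finset.sum_eq_single x] <;> simp +contextual

/-- Among the points of a pointed polyhedral cone at which `w₀` is positive there is one that is
determined up to scaling by the constraints that are tight at it. -/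
theorem exists_extreme_direction [DecidableEq V] (W : Finset (V → ℤ)) (w₀ : V → ℤ)
    (hcoord : ∀ x, Pi.single x 1 ∈ W ∨ Pi.single x (-1) ∈ W)
    (h : ∃ d, (∀ w ∈ W, 0 ≤ intDot w d) ∧ 0 < intDot w₀ d) :
    ∃ d, (∀ w ∈ W, 0 ≤ intDot w d) ∧ 0 < intDot w₀ d ∧
      ∀ e, (∀ w ∈ W, intDot w d = 0 → intDot w e = 0) → intDot w₀ e = 0 → e = 0 := by
  let tight : (V → ℝ) → Finset (V → ℤ) := fun d => W.filter fun w => intDot w d = 0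
  let P : ℕ → Prop := fun k =>
    ∃ d, (∀ w ∈ W, 0 ≤ intDot w d) ∧ 0 < intDot w₀ d ∧ (tight d).card = k
  obtain ⟨d₁, hd₁, hd₁'⟩ := h
  have hbound : ∀ k, P k → k ≤ W.card := by
    rintro k ⟨d, -, -, rfl⟩
    exact Finset.card_filter_le _ _
  have hP : P (tight d₁).card := ⟨d₁, hd₁, hd₁', rfl⟩
  obtain ⟨d, hd, hpos, hcard⟩ : P (Nat.findGreatest P W.card) :=
    Nat.findGreatest_spec (hbound _ hP) hP
  have hmax : ∀ d', (∀ w ∈ W, 0 ≤ intDot w d') → 0 < intDot w₀ d' →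
      (tight d').card ≤ (tight d).card := fun d' h1 h2 => by
    rw [hcard]
    have hP' : P (tight d').card := ⟨d', h1, h2, rfl⟩
    exact Nat.le_findGreatest (hbound _ hP') hP'
  have key : ∀ e, (∀ w ∈ W, intDot w d = 0 → intDot w e = 0) → intDot w₀ e = 0 →
      ∀ w ∈ W, 0 ≤ intDot w e := by
    intro e he he₀
    by_contra! hneg
    let R := W.filter fun w => intDot w e < 0
    have hR : R.Nonempty := hneg.imp fun w hw => Finset.mem_filter.2 hw
    obtain ⟨w₁, hw₁, hmin⟩ := R.exists_min_image (fun w => intDot w d / (-intDot w e)) hR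
    obtain ⟨hw₁W, hw₁e⟩ := Finset.mem_filter.1 hw₁
    set t := intDot w₁ d / (-intDot w₁ e) with ht
    have ht0 : 0 ≤ t := div_nonneg (hd _ hw₁W) (by linarith)
    have hcone : ∀ w ∈ W, 0 ≤ intDot w (d + t • e) := fun w hw => by
      rw [intDot_add_smul]
      rcases le_or_gt 0 (intDot w e) with h0 | h0
      · exact add_nonneg (hd w hw) (mul_nonneg ht0 h0)
      · have := hmin w (Finset.mem_filter.2 ⟨hw, h0⟩)
        rw [le_div_iff₀ (by linarith)] at this
        linarith
    have hlt : tight d ⊂ tight (d + t • e) := by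
      refine Finset.ssubset_iff_of_subset ?_ |>.2 ⟨w₁, ?_, ?_⟩
      · intro w hw
        obtain ⟨hwW, hwd⟩ := Finset.mem_filter.1 hw
        refine Finset.mem_filter.2 ⟨hwW, ?_⟩
        rw [intDot_add_smul, hwd, he w hwW hwd]; simp
      · refine Finset.mem_filter.2 ⟨hw₁W, ?_⟩
        rw [intDot_add_smul, ht]
        field_simp [hw₁e.ne]
        ring
      · intro hw
        exact hw₁e.ne (he w₁ hw₁W (Finset.mem_filter.1 hw).2)
    refine absurd (Finset.card_lt_card hlt) (not_lt.2 (hmax _ hcone ?_))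
    rwa [intDot_add_smul, he₀, mul_zero, add_zero]
  refine ⟨d, hd, hpos, fun e he he₀ => ?_⟩
  have h1 := key e he he₀
  have h2 := key (-e) (fun w hw hwd => by rw [intDot_neg, he w hw hwd, neg_zero])
    (by rw [intDot_neg, he₀, neg_zero])
  funext x
  rcases hcoord x with hx | hx <;>
  · have h1x := h1 _ hx
    have h2x := h2 _ hx
    rw [intDot_neg] at h2x
    rw [intDot_single] at h1x h2x
    push_cast at h1x h2x
    simp only [Pi.zero_apply]
    linarith

/-- A direction determined up to scaling by linear equations with coefficients in `{-1, 0, 1}` has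
a positive multiple with integer entries of absolute value at most `n ^ (n / 2)`. -/
theorem exists_bounded_integer_multiple (T : Set (V → ℤ)) (w₀ : V → ℤ)
    (hT : ∀ w ∈ T, ∀ x, |w x| ≤ 1) (hw₀ : ∀ x, |w₀ x| ≤ 1) (d : V → ℝ)
    (hd : ∀ w ∈ T, intDot w d = 0) (hpos : 0 < intDot w₀ d)
    (huniq : ∀ e, (∀ w ∈ T, intDot w e = 0) → intDot w₀ e = 0 → e = 0) :
    ∃ c : ℝ, 0 < c ∧ ∃ z : V → ℤ, ∀ x, (z x : ℝ) = c * d x ∧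
      |(z x : ℝ)| ≤ √(Fintype.card V : ℝ) ^ Fintype.card V := by
  let toReal : (V → ℤ) → V → ℝ := fun w x => (w x : ℝ)
  let s : Set (V → ℝ) := toReal '' (insert w₀ T)
  have hspan : Submodule.span ℝ s = ⊤ := by
    by_contra hne
    obtain ⟨f, hf0, hf⟩ := Submodule.exists_le_ker_of_lt_top _ (lt_top_iff_ne_top.2 hne)
    have hfs : ∀ w ∈ insert w₀ T, intDot w (fun x => f (Pi.single x 1)) = 0 := fun w hw => by
      have : f (toReal w) = 0 := hf (Submodule.subset_span ⟨w, hw, rfl⟩)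
      rw [LinearMap.pi_apply_eq_sum_univ] at this
      refine Eq.trans (Finset.sum_congr rfl fun x _ => ?_) this
      rw [smul_eq_mul]
      refine congrArg (fun u => (w x : ℝ) * f u) (funext fun y => ?_)
      simp only [Pi.single_apply, eq_comm]
    have h0 := huniq _ (fun w hw => hfs w (Set.mem_insert_of_mem _ hw))
      (hfs w₀ (Set.mem_insert _ _))
    apply hf0
    ext x
    exact congrFun h0 x
  have hrank : Module.finrank ℝ (Submodule.span ℝ s) = Fintype.card V := by
    rw [hspan, finrank_top, Module.finrank_fintype_fun_eq_card]
  obtain ⟨f, hfs, -, hfind⟩ := Submodule.exists_fun_fin_finrank_span_eq ℝ s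
  let e : V ≃ Fin (Module.finrank ℝ (Submodule.span ℝ s)) := Fintype.equivFinOfCardEq hrank.symm
  choose g hgT hgf using fun v => hfs (e v)
  have hgT' : ∀ v, g v = w₀ ∨ g v ∈ T := fun v => Set.mem_insert_iff.1 (hgT v)
  have hginj : Function.Injective g := fun v v' h => e.injective <| hfind.injective <| by
    rw [← hgf v, ← hgf v', h]
  let M : Matrix V V ℤ := Matrix.of g
  let MR : Matrix V V ℝ := M.map (Int.castRingHom ℝ)
  have hentry : ∀ v x, |M v x| ≤ 1 := fun v x => by
    rcases hgT' v with h | h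
    · exact (congrArg (fun w : V → ℤ => |w x|) h).trans_le (hw₀ x)
    · exact hT _ h x
  have hdet : MR.det ≠ 0 := by
    have hrows : LinearIndependent ℝ MR.row := by
      have : MR.row = f ∘ e := funext fun v => hgf v
      rw [this]
      exact hfind.comp _ e.injective
    exact ((Matrix.isUnit_iff_isUnit_det _).1
      (Matrix.linearIndependent_rows_iff_isUnit.1 hrows)).ne_zero
  have hmul : ∀ v, (MR.mulVec d) v = intDot (g v) d := fun v => rfl
  have hd0 : d ≠ 0 := by
    rintro rfl
    simp [intDot] at hpos
  obtain ⟨j, hj⟩ : ∃ j, g j = w₀ := by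
    by_contra! hne
    refine hd0 (Matrix.eq_zero_of_mulVec_eq_zero hdet (funext fun v => ?_))
    rw [hmul]
    exact hd _ ((hgT' v).resolve_left (hne v))
  have hMd : MR.mulVec d = Pi.single j (intDot w₀ d) := by
    funext v
    rw [hmul]
    rcases eq_or_ne v j with rfl | hv
    · rw [hj, Pi.single_eq_same]
    · rw [Pi.single_eq_of_ne hv]
      exact hd _ ((hgT' v).resolve_left fun h => hv (hginj (h.trans hj.symm)))
  have hadj : ∀ x, MR.det * d x = MR.adjugate x j * intDot w₀ d := fun x => by
    have h := congrArg (fun u => MR.adjugate.mulVec u x) hMd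
    simpa [Matrix.mulVec_mulVec, Matrix.adjugate_mul, Matrix.smul_mulVec] using h
  have hcast : ∀ x, ((M.adjugate x j : ℤ) : ℝ) = MR.adjugate x j := fun x => by
    have h := (Int.castRingHom ℝ).map_adjugate M
    exact congrFun (congrFun h x) j
  have hle : ∀ x, |MR.adjugate x j| ≤ √(Fintype.card V : ℝ) ^ Fintype.card V := fun x => by
    rw [Matrix.adjugate_apply]
    refine abs_det_le_sqrt_card_pow _ fun v y => ?_
    rw [Matrix.updateRow_apply]
    split_ifs
    · rw [Pi.single_apply]
      split_ifs <;> simp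
    · have : MR v y = (M v y : ℝ) := rfl
      rw [this]
      exact_mod_cast hentry v y
  have hadj' : ∀ x, MR.adjugate x j = MR.det / intDot w₀ d * d x := fun x => by
    rw [div_mul_eq_mul_div, hadj, mul_div_cancel_right₀ _ hpos.ne']
  rcases lt_or_gt_of_ne hdet with hneg | hgt
  · refine ⟨-(MR.det / intDot w₀ d), neg_pos.2 (div_neg_of_neg_of_pos hneg hpos),
      fun x => -M.adjugate x j, fun x => ⟨?_, ?_⟩⟩
    · rw [Int.cast_neg, hcast, hadj', neg_mul]
    · rw [Int.cast_neg, hcast, abs_neg]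
      exact hle x
  · refine ⟨MR.det / intDot w₀ d, div_pos hgt hpos,
      fun x => M.adjugate x j, fun x => ⟨?_, ?_⟩⟩
    · rw [hcast, hadj']
    · rw [hcast]
      exact hle x

end IntDot

section Preferences

variable {X : Type*} {r : X → X → Prop}

theorem IsPrefOrder.strictPref_of_not (hr : IsPrefOrder r) {x y : X} (h : ¬ r x y) :
    strictPref r y x :=
  ⟨(hr.1 x y).resolve_left h, h⟩

theorem IsPrefOrder.strictPref_of_strictPref_of_pref (hr : IsPrefOrder r) {x y z : X}
    (hxy : strictPref r x y) (hyz : r y z) : strictPref r x z :=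
  ⟨hr.2 hxy.1 hyz, fun h => hxy.2 (hr.2 hyz h)⟩

theorem IsPrefOrder.strictPref_of_pref_of_strictPref (hr : IsPrefOrder r) {x y z : X}
    (hxy : r x y) (hyz : strictPref r y z) : strictPref r x z :=
  ⟨hr.2 hxy hyz.1, fun h => hyz.2 (hr.2 h hxy)⟩

theorem IsPrefOrder.exists_best [Finite X] (hr : IsPrefOrder r) {A : Set X} (hA : A.Nonempty) :
    ∃ z ∈ A, ∀ y ∈ A, r z y := by
  have : IsTrans X (strictPref r) :=
    ⟨fun _ _ _ h h' => hr.strictPref_of_strictPref_of_pref h h'.1⟩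
  have : Std.Irrefl (strictPref r) := ⟨fun _ h => h.2 h.1⟩
  obtain ⟨z, hz, hmin⟩ :=
    (Finite.wellFounded_of_trans_of_irrefl (strictPref r)).has_min A hA
  exact ⟨z, hz, fun y hy => by_contra fun h => hmin y hy (hr.strictPref_of_not h)⟩

variable [Fintype X]

theorem upWeight_add_smul (r : X → X → Prop) (p d : X → ℝ) (t : ℝ) (x : X) :
    upWeight r (fun y => p y + t * d y) x = upWeight r p x + t * upWeight r d x := by
  simp only [upWeight, Finset.sum_add_distrib, Finset.mul_sum]

theorem upWeight_sub (r : X → X → Prop) (p q : X → ℝ) (x : X) :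
    upWeight r (fun y => p y - q y) x = upWeight r p x - upWeight r q x := by
  simp only [upWeight, Finset.sum_sub_distrib]

/-- For weights of total `0` concentrated on a set `Q`, every upper weight is either `0` or the
upper weight at an element of `Q`. -/
theorem IsPrefOrder.upWeight_eq_zero_or_eq (hr : IsPrefOrder r) (Q : X → Prop) (x : X) :
    (∀ d : X → ℝ, (∀ y, ¬ Q y → d y = 0) → ∑ y, d y = 0 → upWeight r d x = 0) ∨
      ∃ z, Q z ∧ ∀ d : X → ℝ, (∀ y, ¬ Q y → d y = 0) → upWeight r d x = upWeight r d z := by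
  rcases Set.eq_empty_or_nonempty {z | Q z ∧ r x z} with hA | hA
  · left
    intro d hd hsum
    rw [← hsum, upWeight]
    refine Finset.sum_filter_of_ne fun y _ hy => hr.strictPref_of_not fun h => ?_
    have : y ∈ {z | Q z ∧ r x z} := ⟨by_contra fun hQ => hy (hd y hQ), h⟩
    simp [hA] at this
  · right
    obtain ⟨z, ⟨hQz, hxz⟩, hz⟩ := hr.exists_best hA
    refine ⟨z, hQz, fun d hd => ?_⟩
    rw [upWeight, upWeight, Finset.sum_filter, Finset.sum_filter]
    refine Finset.sum_congr rfl fun y _ => ?_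
    by_cases hQ : Q y
    · refine if_congr ⟨fun h => hr.strictPref_of_strictPref_of_pref h hxz, fun h => ?_⟩ rfl rfl
      exact hr.strictPref_of_not fun hxy => h.2 (hz y ⟨hQ, hxy⟩)
    · simp [hd y hQ]

end Preferences

section Directions

variable {X N : Type*} [Fintype X] {pref : N → X → X → Prop}

/-- Every outcome is weakly Pareto dominated by a Pareto optimal one. -/
theorem exists_paretoOptimal_pref (hpref : ∀ i, IsPrefOrder (pref i)) (y : X) :
    ∃ z, ParetoOptimal pref z ∧ ∀ i, pref i z y := by
  let D : X → X → Prop := fun z y => (∀ i, pref i z y) ∧ ∃ j, strictPref (pref j) z y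
  have : IsTrans X D := ⟨fun _ _ _ h h' => ⟨fun i => (hpref i).2 (h.1 i) (h'.1 i),
    h.2.imp fun j hj => (hpref j).strictPref_of_strictPref_of_pref hj (h'.1 j)⟩⟩
  have : Std.Irrefl D := ⟨fun _ h => h.2.elim fun _ hj => hj.2 hj.1⟩
  obtain ⟨z, hz, hmin⟩ := (Finite.wellFounded_of_trans_of_irrefl D).has_min
    {z | ∀ i, pref i z y} ⟨y, fun i => ((hpref i).1 y y).elim id id⟩
  exact ⟨z, fun ⟨w, hw⟩ => hmin w (fun i => (hpref i).2 (hw.1 i) (hz i)) hw, hz⟩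

/-- A signed weight on the Pareto optimal outcomes, of total `0` and nonnegative outside `S`, in the
direction of which any lottery with support `S` can be improved. -/
structure IsImproving (pref : N → X → X → Prop) (S : Finset X) (d : X → ℝ) : Prop where
  eq_zero : ∀ y, ¬ ParetoOptimal pref y → d y = 0
  sum_eq_zero : ∑ y, d y = 0
  nonneg : ∀ y, y ∉ S → 0 ≤ d y
  upWeight_nonneg : ∀ i x, ParetoOptimal pref x → 0 ≤ upWeight (pref i) d x
  upWeight_pos : ∃ i x, ParetoOptimal pref x ∧ 0 < upWeight (pref i) d x

theorem IsImproving.not_exAnteEff {S : Finset X} {d : X → ℝ}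
    (hpref : ∀ i, IsPrefOrder (pref i)) (hd : IsImproving pref S d) {p : X → ℝ}
    (hp : IsLottery p) (hpS : ∀ x ∈ S, 0 < p x) : ¬ ExAnteEff pref p := by
  obtain ⟨t, ht, htp⟩ : ∃ t : ℝ, 0 < t ∧ ∀ x ∈ S, t * |d x| ≤ p x := by
    have hev : ∀ᶠ t in nhdsWithin (0 : ℝ) (Set.Ioi 0), ∀ x ∈ S, t * |d x| ≤ p x := by
      refine (Filter.eventually_all_finset S).2 fun x hx => ?_
      have : Filter.Tendsto (fun t : ℝ => t * |d x|) (nhdsWithin 0 (Set.Ioi 0)) (nhds 0) := by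
        have h : Filter.Tendsto (fun t : ℝ => t * |d x|) (nhds 0) (nhds (0 * |d x|)) :=
          Continuous.tendsto (by fun_prop) 0
        rw [zero_mul] at h
        exact h.mono_left nhdsWithin_le_nhds
      exact this.eventually_le_const (hpS x hx)
    obtain ⟨t, h1, h2⟩ := (hev.and self_mem_nhdsWithin).exists
    exact ⟨t, h2, h1⟩
  have hup : ∀ i x, 0 ≤ upWeight (pref i) d x := fun i x => by
    rcases (hpref i).upWeight_eq_zero_or_eq (ParetoOptimal pref) x with h | ⟨z, hz, h⟩
    · exact (h d hd.eq_zero hd.sum_eq_zero).ge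
    · exact (hd.upWeight_nonneg i z hz).trans_eq (h d hd.eq_zero).symm
  have hge : ∀ i, SDge (pref i) (fun y => p y + t * d y) p := fun i x => by
    rw [upWeight_add_smul]
    exact le_add_of_nonneg_right (mul_nonneg ht.le (hup i x))
  obtain ⟨j, x, -, hx⟩ := hd.upWeight_pos
  refine fun h => h ⟨fun y => p y + t * d y, ⟨fun y => ?_, ?_⟩, hge, j, hge j, x, ?_⟩
  · by_cases hy : y ∈ S
    · have h1 := htp y hy
      have h2 := mul_le_mul_of_nonneg_left (neg_abs_le (d y)) ht.le
      linarith
    · exact add_nonneg (hp.1 y) (mul_nonneg ht.le (hd.nonneg y hy))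
  · rw [Finset.sum_add_distrib, ← Finset.mul_sum, hd.sum_eq_zero, hp.2, mul_zero, add_zero]
  · rw [upWeight_add_smul]
    exact lt_add_of_pos_right _ (mul_pos ht hx)

/-- An inefficient lottery on Pareto optimal outcomes admits an improving direction. -/
theorem exists_isImproving_of_not_exAnteEff {S : Finset X} (hpref : ∀ i, IsPrefOrder (pref i))
    (hS : ∀ x ∈ S, ParetoOptimal pref x) {p : X → ℝ} (hp : IsLottery p)
    (hpS : ∀ x, x ∉ S → p x = 0) (h : ¬ ExAnteEff pref p) : ∃ d, IsImproving pref S d := by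
  obtain ⟨q, hq, hge, j, -, x, hx⟩ := not_not.1 h
  choose f hfP hf using exists_paretoOptimal_pref hpref
  let q' : X → ℝ := fun z => ∑ y ∈ Finset.univ.filter (fun y => f y = z), q y
  have hq'0 : ∀ z, 0 ≤ q' z := fun z => Finset.sum_nonneg fun y _ => hq.1 y
  have hq'sum : ∀ A : Finset X, ∑ z ∈ A, q' z =
      ∑ y ∈ Finset.univ.filter (fun y => f y ∈ A), q y := by
    intro A
    rw [← Finset.sum_fiberwise_of_maps_to (t := A) (g := f)
      (fun y hy => (Finset.mem_filter.1 hy).2)]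
    refine Finset.sum_congr rfl fun z hz => ?_
    rw [Finset.filter_filter]
    refine Finset.sum_congr (Finset.filter_congr fun y _ => ?_) fun _ _ => rfl
    exact ⟨fun h => ⟨h ▸ hz, h⟩, fun h => h.2⟩
  have hup : ∀ i x, upWeight (pref i) q x ≤ upWeight (pref i) q' x := fun i x => by
    rw [upWeight, upWeight, hq'sum]
    refine Finset.sum_le_sum_of_subset_of_nonneg (fun y hy => ?_) fun y _ _ => hq.1 y
    simp only [Finset.mem_filter, Finset.mem_univ, true_and] at hy ⊢
    exact (hpref i).strictPref_of_pref_of_strictPref (hf y i) hy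
  let d : X → ℝ := fun y => q' y - p y
  have hd0 : ∀ y, ¬ ParetoOptimal pref y → d y = 0 := fun y hy => by
    have h1 : q' y = 0 := by
      refine Finset.sum_eq_zero fun w hw => ?_
      exact absurd ((Finset.mem_filter.1 hw).2 ▸ hfP w) hy
    have h2 : p y = 0 := hpS y fun h => hy (hS y h)
    simp only [d, h1, h2, sub_zero]
  have hdsum : ∑ y, d y = 0 := by
    simp only [d, Finset.sum_sub_distrib, hq'sum, hp.2]
    simp [hq.2]
  refine ⟨d, hd0, hdsum, fun y hy => ?_, fun i z _ => ?_, j, ?_⟩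
  · simp only [d, hpS y hy, sub_zero, hq'0]
  · rw [upWeight_sub, sub_nonneg]
    exact (hge i z).trans (hup i z)
  · have hpos : 0 < upWeight (pref j) d x := by
      rw [upWeight_sub, sub_pos]
      exact hx.trans_le (hup j x)
    rcases (hpref j).upWeight_eq_zero_or_eq (ParetoOptimal pref) x with h | ⟨z, hz, h⟩
    · exact absurd (h d hd0 hdsum) hpos.ne'
    · exact ⟨z, hz, (h d hd0) ▸ hpos⟩

/-- A nonempty set of Pareto optimal outcomes supports an ex-ante efficient lottery iff there is no
improving direction. -/
theorem exists_exAnteEff_iff_not_exists_isImproving {S : Finset X}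
    (hpref : ∀ i, IsPrefOrder (pref i)) (hSne : S.Nonempty)
    (hS : ∀ x ∈ S, ParetoOptimal pref x) :
    (∃ p : X → ℝ, IsLottery p ∧ ExAnteEff pref p ∧ (∀ x, 0 < p x ↔ x ∈ S)) ↔
      ¬ ∃ d, IsImproving pref S d := by
  constructor
  · rintro ⟨p, hp, heff, hpS⟩ ⟨d, hd⟩
    exact hd.not_exAnteEff hpref hp (fun x hx => (hpS x).2 hx) heff
  · intro h
    have hcard : (0 : ℝ) < S.card := by exact_mod_cast hSne.card_pos
    let p : X → ℝ := fun x => if x ∈ S then (S.card : ℝ)⁻¹ else 0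
    have hp : IsLottery p := by
      refine ⟨fun x => ?_, ?_⟩
      · simp only [p]; split_ifs <;> positivity
      · simp [p, Finset.sum_ite_mem, hcard.ne']
    refine ⟨p, hp, ?_, fun x => ?_⟩
    · by_contra hne
      exact h (exists_isImproving_of_not_exAnteEff hpref hS hp (fun x hx => if_neg hx) hne)
    · by_cases hx : x ∈ S <;> simp [p, hx, hSne.card_pos]

end Directions

section Sequences

variable {X : Type*} [Fintype X]

theorem exists_sequence_of_multiplicities (m : X → ℕ) {K : ℕ} (hK : ∑ x, m x = K) :
    ∃ a : Fin K → X, ∀ x, (Finset.univ.filter fun k => a k = x).card = m x := by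
  let e : (Σ x, Fin (m x)) ≃ Fin K := Fintype.equivFinOfCardEq (by simp [hK])
  refine ⟨fun k => (e.symm k).1, fun x => ?_⟩
  rw [← Fintype.card_subtype]
  have e' : {k : Fin K // (e.symm k).1 = x} ≃ Fin (m x) :=
    (e.symm.subtypeEquiv fun _ => Iff.rfl).trans (Equiv.sigmaSubtype x)
  rw [Fintype.card_congr e', Fintype.card_fin]

theorem upWeight_multiplicities (r : X → X → Prop) {K : ℕ} (f : Fin K → X) (x : X) :
    upWeight r (fun y => ((Finset.univ.filter fun k => f k = y).card : ℝ)) x =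
      (Finset.univ.filter fun k => strictPref r (f k) x).card := by
  rw [upWeight, ← Nat.cast_sum, Nat.cast_inj,
    Finset.card_eq_sum_card_fiberwise (f := f) (t := Finset.univ.filter fun y => strictPref r y x)
      (fun k hk => by simpa using hk)]
  refine Finset.sum_congr rfl fun y hy => ?_
  rw [Finset.filter_filter]
  refine congrArg Finset.card (Finset.filter_congr fun k _ => ?_)
  exact ⟨fun h => ⟨h ▸ (Finset.mem_filter.1 hy).2, h⟩, fun h => h.2⟩

theorem sum_multiplicities {K : ℕ} (f : Fin K → X) :
    ∑ x, ((Finset.univ.filter fun k => f k = x).card : ℝ) = K := by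
  rw [← Nat.cast_sum, ← Finset.card_eq_sum_card_fiberwise (fun k _ => Finset.mem_univ (f k)),
    Finset.card_univ, Fintype.card_fin]

end Sequences

section BoundedDirections

variable {X N : Type*} [Fintype X] {pref : N → X → X → Prop}

/-- The difference of the multiplicities of a dominating and a dominated sequence is an improving
direction. -/
theorem isImproving_multiplicities {S : Finset X} {K : ℕ} {a b : Fin K → X}
    (hS : ∀ x ∈ S, ParetoOptimal pref x) (ha : ∀ k, ParetoOptimal pref (a k)) (hb : ∀ k, b k ∈ S)
    (hge : ∀ i x, ParetoOptimal pref x →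
      (Finset.univ.filter (fun k => strictPref (pref i) (b k) x)).card ≤
        (Finset.univ.filter (fun k => strictPref (pref i) (a k) x)).card)
    (hgt : ∃ i x, ParetoOptimal pref x ∧
      (Finset.univ.filter (fun k => strictPref (pref i) (b k) x)).card <
        (Finset.univ.filter (fun k => strictPref (pref i) (a k) x)).card) :
    IsImproving pref S fun x => ((Finset.univ.filter fun k => a k = x).card : ℝ) -
      ((Finset.univ.filter fun k => b k = x).card : ℝ) := by
  have hb0 : ∀ y, y ∉ S → (Finset.univ.filter fun k => b k = y).card = 0 := fun y hy =>
    Finset.card_eq_zero.2 (Finset.filter_eq_empty_iff.2 fun k _ h => hy (h ▸ hb k))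
  refine ⟨fun y hy => ?_, ?_, fun y hy => ?_, fun i x hx => ?_, ?_⟩
  · have ha0 : (Finset.univ.filter fun k => a k = y).card = 0 :=
      Finset.card_eq_zero.2 (Finset.filter_eq_empty_iff.2 fun k _ h => hy (h ▸ ha k))
    rw [ha0, hb0 y fun h => hy (hS y h), sub_self]
  · rw [Finset.sum_sub_distrib, sum_multiplicities, sum_multiplicities, sub_self]
  · simp [hb0 y hy]
  · rw [upWeight_sub, upWeight_multiplicities, upWeight_multiplicities, sub_nonneg]
    exact_mod_cast hge i x hx
  · obtain ⟨i, x, hx, h⟩ := hgt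
    refine ⟨i, x, hx, ?_⟩
    rw [upWeight_sub, upWeight_multiplicities, upWeight_multiplicities, sub_pos]
    exact_mod_cast h

/-- If there is an improving direction, there is one with integer entries of absolute value at most
`n ^ (n / 2)`, where `n` is the number of Pareto optimal outcomes. -/
theorem IsImproving.exists_bounded_integer [Finite N] {S : Finset X} {d : X → ℝ}
    (hd : IsImproving pref S d) :
    ∃ z : X → ℤ, IsImproving pref S (fun x => (z x : ℝ)) ∧
      ∀ x, |(z x : ℝ)| ≤ √((Finset.univ.filter (fun y => ParetoOptimal pref y)).card : ℝ) ^
        (Finset.univ.filter (fun y => ParetoOptimal pref y)).card := by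
  have := Fintype.ofFinite N
  let V := {x : X // ParetoOptimal pref x}
  let up : N → X → V → ℤ := fun i x y => if strictPref (pref i) y x then 1 else 0
  let sgn : V → ℤ := fun x => if 0 ≤ d x then 1 else -1
  let W : Finset (V → ℤ) := Finset.univ.image (fun ix : N × V => up ix.1 ix.2) ∪
    ({fun _ => 1, fun _ => -1} ∪ Finset.univ.image fun x => Pi.single x (sgn x))
  have hupW : ∀ i (x : V), up i x ∈ W := fun i x =>
    Finset.mem_union_left _ (Finset.mem_image_of_mem (fun ix : N × V => up ix.1 ix.2)
      (Finset.mem_univ (i, x)))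
  have hsgnW : ∀ x, Pi.single x (sgn x) ∈ W := fun x =>
    Finset.mem_union_right _ (Finset.mem_union_right _
      (Finset.mem_image_of_mem (fun x => Pi.single x (sgn x)) (Finset.mem_univ x)))
  have honeW : (fun _ => 1) ∈ W := by simp [W]
  have hnegW : (fun _ => -1) ∈ W := by simp [W]
  have hsum : ∀ g : X → ℝ, (∀ y, ¬ ParetoOptimal pref y → g y = 0) →
      ∑ y : V, g y = ∑ y, g y := fun g hg => by
    rw [← Finset.sum_subtype (Finset.univ.filter fun y => ParetoOptimal pref y) (by simp) g]
    exact Finset.sum_filter_of_ne fun y _ hy => by_contra fun h => hy (hg y h)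
  have hupDot : ∀ i x (g : X → ℝ), (∀ y, ¬ ParetoOptimal pref y → g y = 0) →
      intDot (up i x) (fun y : V => g y) = upWeight (pref i) g x := fun i x g hg => by
    rw [upWeight, Finset.sum_filter, ← hsum _ fun y hy => by simp [hg y hy]]
    exact Finset.sum_congr rfl fun y _ => by simp only [up]; split_ifs <;> simp
  have hentry : ∀ w ∈ W, ∀ x, |w x| ≤ 1 := by
    intro w hw x
    simp only [W, Finset.mem_union, Finset.mem_image, Finset.mem_univ, true_and,
      Finset.mem_insert, Finset.mem_singleton] at hw
    rcases hw with ⟨ix, rfl⟩ | (rfl | rfl) | ⟨y, rfl⟩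
    · simp only [up]; split_ifs <;> simp
    · simp
    · simp
    · simp only [Pi.single_apply, sgn]; split_ifs <;> simp
  obtain ⟨i₀, x₀, hx₀, hpos₀⟩ := hd.upWeight_pos
  have hfeas : ∀ w ∈ W, 0 ≤ intDot w fun y : V => d y := by
    intro w hw
    simp only [W, Finset.mem_union, Finset.mem_image, Finset.mem_univ, true_and,
      Finset.mem_insert, Finset.mem_singleton] at hw
    rcases hw with ⟨ix, rfl⟩ | (rfl | rfl) | ⟨y, rfl⟩
    · rw [hupDot _ _ d hd.eq_zero]
      exact hd.upWeight_nonneg _ _ ix.2.2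
    · simp [intDot, hsum d hd.eq_zero, hd.sum_eq_zero]
    · simp [intDot, hsum d hd.eq_zero, hd.sum_eq_zero]
    · rw [intDot_single]
      simp only [sgn]
      split_ifs with h
      · simpa using h
      · simpa using (not_le.1 h).le
  obtain ⟨d', hd', hpos', huniq⟩ := exists_extreme_direction W (up i₀ x₀)
    (fun x => by
      have h := hsgnW x
      simp only [sgn] at h
      split_ifs at h
      exacts [Or.inl h, Or.inr h])
    ⟨_, hfeas, (hupDot i₀ x₀ d hd.eq_zero).symm ▸ hpos₀⟩
  obtain ⟨c, hc, z, hz⟩ := exists_bounded_integer_multiple {w | w ∈ W ∧ intDot w d' = 0}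
    (up i₀ x₀) (fun w hw => hentry w hw.1) (hentry _ (hupW i₀ ⟨x₀, hx₀⟩)) d'
    (fun w hw => hw.2) hpos' fun e he => huniq e fun w hw hw0 => he w ⟨hw, hw0⟩
  have hzdot : ∀ w, intDot w (fun y => (z y : ℝ)) = c * intDot w d' := fun w => by
    simp only [intDot, (hz _).1, Finset.mul_sum]
    exact Finset.sum_congr rfl fun y _ => by ring
  let z' : X → ℤ := fun x => if h : ParetoOptimal pref x then z ⟨x, h⟩ else 0
  have hz'0 : ∀ y, ¬ ParetoOptimal pref y → (z' y : ℝ) = 0 := fun y hy => by simp [z', hy]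
  have hz' : (fun y : V => (z' y : ℝ)) = fun y => (z y : ℝ) := funext fun y => by simp [z', y.2]
  have hz'up : ∀ i x, upWeight (pref i) (fun y => (z' y : ℝ)) x = c * intDot (up i x) d' :=
    fun i x => by rw [← hupDot i x _ hz'0, hz', hzdot]
  refine ⟨z', ⟨hz'0, ?_, fun y hy => ?_, fun i x hx => ?_, i₀, x₀, hx₀, ?_⟩, fun x => ?_⟩
  · have h1 := hd' _ honeW
    have h2 := hd' _ hnegW
    have h3 : intDot (fun _ => 1) d' = 0 := by
      simp only [intDot, Int.cast_one, Int.cast_neg, neg_mul, Finset.sum_neg_distrib] at h1 h2 ⊢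
      linarith
    rw [← hsum _ hz'0, hz', ← mul_zero c, ← h3, ← hzdot]
    simp [intDot]
  · by_cases h : ParetoOptimal pref y
    · have h1 := hd' _ (hsgnW ⟨y, h⟩)
      have h2 : sgn ⟨y, h⟩ = 1 := if_pos (hd.nonneg y hy)
      rw [intDot_single, h2, Int.cast_one, one_mul] at h1
      simp only [z', h, dite_true, (hz _).1]
      exact mul_nonneg hc.le h1
    · exact (hz'0 y h).ge
  · rw [hz'up]
    exact mul_nonneg hc.le (hd' _ (hupW i ⟨x, hx⟩))
  · rw [hz'up]
    exact mul_pos hc hpos'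
  · have hcard : Fintype.card V = (Finset.univ.filter (fun y => ParetoOptimal pref y)).card :=
      Fintype.card_subtype _
    rw [← hcard]
    by_cases h : ParetoOptimal pref x
    · simp only [z', h, dite_true]
      exact (hz _).2
    · rw [hz'0 x h, abs_zero]
      positivity

end BoundedDirections

theorem sqrt_pow_eq_exp {n : ℕ} (hn : 0 < n) :
    √(n : ℝ) ^ n = Real.exp ((n : ℝ) * Real.log (n : ℝ) / 2) := by
  rw [mul_div_assoc, Real.exp_nat_mul, Real.exp_half, Real.exp_log (by exact_mod_cast hn)]

/-- A nonempty set `S` of Pareto optimal outcomes supports an ex-ante efficient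
lottery iff there is no pair of dominating/dominated sequences of outcomes, with
multiplicities bounded by `exp((1/2)|X*| ln |X*|)`. -/
theorem stmt_3 {X N : Type*} [Fintype X] [Nonempty X] [Fintype N] [Nonempty N]
    (pref : N → X → X → Prop) (hpref : ∀ i, IsPrefOrder (pref i))
    (S : Finset X) (hSne : S.Nonempty) (hS : ∀ x ∈ S, ParetoOptimal pref x) :
    (∃ p : X → ℝ, IsLottery p ∧ ExAnteEff pref p ∧ (∀ x, 0 < p x ↔ x ∈ S)) ↔
      ¬ ∃ K : ℕ, 1 ≤ K ∧ ∃ a b : Fin K → X,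
        (∀ k, ParetoOptimal pref (a k)) ∧
        (∀ k, b k ∈ S) ∧
        (∀ k l, a k ≠ b l) ∧
        (∀ x : X,
          ((Finset.univ.filter (fun k => a k = x)).card : ℝ) ≤
            Real.exp (((Finset.univ.filter (fun y => ParetoOptimal pref y)).card : ℝ) *
              Real.log ((Finset.univ.filter (fun y => ParetoOptimal pref y)).card : ℝ) / 2) ∧
          ((Finset.univ.filter (fun k => b k = x)).card : ℝ) ≤
            Real.exp (((Finset.univ.filter (fun y => ParetoOptimal pref y)).card : ℝ) *
              Real.log ((Finset.univ.filter (fun y => ParetoOptimal pref y)).card : ℝ) / 2)) ∧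
        (∀ i x, ParetoOptimal pref x →
          (Finset.univ.filter (fun k => strictPref (pref i) (b k) x)).card ≤
            (Finset.univ.filter (fun k => strictPref (pref i) (a k) x)).card) ∧
        (∃ i x, ParetoOptimal pref x ∧
          (Finset.univ.filter (fun k => strictPref (pref i) (b k) x)).card <
            (Finset.univ.filter (fun k => strictPref (pref i) (a k) x)).card) := by
  rw [exists_exAnteEff_iff_not_exists_isImproving hpref hSne hS, not_iff_not]
  constructor
  · rintro ⟨d, hd⟩
    obtain ⟨z, hz, hbound⟩ := hd.exists_bounded_integer
    have hn : 0 < (Finset.univ.filter (fun y => ParetoOptimal pref y)).card :=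
      Finset.card_pos.2 (hSne.imp fun x hx => Finset.mem_filter.2 ⟨Finset.mem_univ x, hS x hx⟩)
    have hsplit : ∀ x, ((z x).toNat : ℤ) - ((-z x).toNat : ℤ) = z x := fun x => by omega
    have hsum : ∑ x, (-z x).toNat = ∑ x, (z x).toNat := by
      have h0 : ∑ x, z x = 0 := by exact_mod_cast hz.sum_eq_zero
      rw [← Finset.sum_congr rfl fun x _ => hsplit x, Finset.sum_sub_distrib, ← Nat.cast_sum,
        ← Nat.cast_sum, sub_eq_zero] at h0
      exact (Nat.cast_inj.1 h0).symm
    obtain ⟨a, ha⟩ := exists_sequence_of_multiplicities (fun x => (z x).toNat) rfl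
    obtain ⟨b, hb⟩ := exists_sequence_of_multiplicities (fun x => (-z x).toNat) hsum
    have hza : ∀ k, 0 < z (a k) := fun k => by
      have : 0 < (z (a k)).toNat := by
        rw [← ha]
        exact Finset.card_pos.2 ⟨k, by simp⟩
      omega
    have hzb : ∀ k, z (b k) < 0 := fun k => by
      have : 0 < (-z (b k)).toNat := by
        rw [← hb]
        exact Finset.card_pos.2 ⟨k, by simp⟩
      omega
    have hdiff : ∀ i x, upWeight (pref i) (fun y => (z y : ℝ)) x =
        (Finset.univ.filter (fun k => strictPref (pref i) (a k) x)).card -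
          (Finset.univ.filter (fun k => strictPref (pref i) (b k) x)).card := fun i x => by
      rw [← upWeight_multiplicities, ← upWeight_multiplicities, ← upWeight_sub]
      refine congrArg (fun g => upWeight (pref i) g x) (funext fun y => ?_)
      rw [ha, hb]
      exact_mod_cast (hsplit y).symm
    have hgt : ∃ i x, ParetoOptimal pref x ∧
        (Finset.univ.filter (fun k => strictPref (pref i) (b k) x)).card <
          (Finset.univ.filter (fun k => strictPref (pref i) (a k) x)).card := by
      obtain ⟨i, x, hx, h⟩ := hz.upWeight_pos
      rw [hdiff, sub_pos] at h
      exact ⟨i, x, hx, by exact_mod_cast h⟩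
    refine ⟨_, ?_, a, b, fun k => ?_, fun k => ?_, fun k l h => ?_, fun x => ?_,
      fun i x hx => ?_, hgt⟩
    · obtain ⟨i, x, -, h⟩ := hgt
      obtain ⟨k, -⟩ := Finset.card_pos.1 (Nat.zero_lt_of_lt h)
      exact k.pos
    · by_contra h
      have h0 : z (a k) = 0 := by exact_mod_cast hz.eq_zero _ h
      exact (hza k).ne' h0
    · by_contra h
      have h0 : 0 ≤ z (b k) := by exact_mod_cast hz.nonneg _ h
      exact (hzb k).not_ge h0
    · exact absurd (hza k) (h ▸ (hzb l).not_gt)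
    · rw [← sqrt_pow_eq_exp hn, ha, hb]
      refine ⟨le_trans ?_ (hbound x), le_trans ?_ (hbound x)⟩
      · have h : ((z x).toNat : ℤ) ≤ |z x| := by rcases abs_cases (z x) <;> omega
        exact_mod_cast h
      · have h : ((-z x).toNat : ℤ) ≤ |z x| := by rcases abs_cases (z x) <;> omega
        exact_mod_cast h
    · have h := hz.upWeight_nonneg i x hx
      rw [hdiff, sub_nonneg] at h
      exact_mod_cast h
  · rintro ⟨K, -, a, b, ha, hb, -, -, hge, hgt⟩
    exact ⟨_, isImproving_multiplicities hS ha hb hge hgt⟩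
end
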